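/- Let a and d be positive integers with 4 ∤ a, 4 ∤ d, and a + d = 4t for an integer t. Then there exist z₁, z₂ ∈ E₈ such that ⟨z₁,z₁⟩ = 2a, ⟨z₂,z₂⟩ = 2t, ⟨z₁,z₂⟩ = −a; the subgroup ℤz₁ + ℤz₂ is primitive in E₈, i.e. (ℚz₁ + ℚz₂) ∩ E₈ = ℤz₁ + ℤz₂; and there exists a ℚ-linear map σ : ℚ⁸ → ℚ⁸ preserving the standard inner product, with σ(E₈) = E₈, σ(z₁) = −z₁, and σ(z₂) = z₁ + z₂. -/

import Mathlib

/-- The `E₈` lattice, realized inside `ℚ⁸`: vectors whose coordinates are all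
integers or all half-integers, with even coordinate sum. -/
def E8lat : Set (Fin 8 → ℚ) :=
  {x | ((∀ i, ∃ n : ℤ, x i = n) ∨ (∀ i, ∃ n : ℤ, x i = n + 1/2)) ∧
       ∃ k : ℤ, (∑ i, x i) = 2 * k}

/-- The standard inner product on `ℚ⁸`. -/
def ip8 (x y : Fin 8 → ℚ) : ℚ := ∑ i, x i * y i

open Quaternion in
def qmk (a b c d : ℤ) : ℍ[ℤ] := ⟨a, b, c, d⟩

lemma qmk_re (a b c d : ℤ) : (qmk a b c d).re = a := rfl
lemma qmk_imI (a b c d : ℤ) : (qmk a b c d).imI = b := rfl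
lemma qmk_imJ (a b c d : ℤ) : (qmk a b c d).imJ = c := rfl
lemma qmk_imK (a b c d : ℤ) : (qmk a b c d).imK = d := rfl

open Quaternion in
lemma q_self_star (x : ℍ[ℤ]) : x * star x = Int.cast (normSq x) := by
  rw [self_mul_star]; ext <;> simp

open Quaternion in
lemma q_star_self (x : ℍ[ℤ]) : star x * x = Int.cast (normSq x) := by
  rw [star_mul_self]; ext <;> simp

lemma aux_alpha (n : ℕ) (hn : 0 < n) (h4 : ¬ 4 ∣ n) :
    ∃ u v : ℤ, (n : ℤ) ∣ 1 + u ^ 2 + v ^ 2 := by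
  obtain ⟨r, hr1, hr2, hr3⟩ : ∃ r : ℕ, r % 4 = 1 ∧ n ∣ r + 1 ∧ Nat.Coprime r (4 * n) := by
    have key : ∀ r : ℕ, r % 4 = 1 → n ∣ r + 1 → Nat.Coprime r (4 * n) := by
      intro r h1 h2
      apply Nat.Coprime.mul_right
      · have : Nat.Coprime r (2 ^ 2) := by
          apply Nat.Coprime.pow_right
          rw [Nat.coprime_two_right, Nat.odd_iff]; omega
        simpa using this
      · exact Nat.Coprime.coprime_dvd_right h2 (by simp)
    have h' : n % 4 = 1 ∨ n % 4 = 2 ∨ n % 4 = 3 := by omega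
    rcases h' with h | h | h
    · have a1 : (2 * n - 1) % 4 = 1 := by omega
      have a2 : n ∣ (2 * n - 1) + 1 := ⟨2, by omega⟩
      exact ⟨_, a1, a2, key _ a1 a2⟩
    · have a1 : (n - 1) % 4 = 1 := by omega
      have a2 : n ∣ (n - 1) + 1 := ⟨1, by omega⟩
      exact ⟨_, a1, a2, key _ a1 a2⟩
    · have a1 : (2 * n - 1) % 4 = 1 := by omega
      have a2 : n ∣ (2 * n - 1) + 1 := ⟨2, by omega⟩
      exact ⟨_, a1, a2, key _ a1 a2⟩
  have : NeZero (4 * n) := ⟨by omega⟩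
  obtain ⟨q, -, hq, hqr⟩ := Nat.forall_exists_prime_gt_and_eq_mod
    ((ZMod.isUnit_iff_coprime r (4 * n)).2 hr3) 0
  rw [ZMod.natCast_eq_natCast_iff] at hqr
  have hq4 : q % 4 = 1 := by
    have : q ≡ r [MOD 4] := hqr.of_dvd (Dvd.intro _ rfl)
    rw [Nat.ModEq] at this; omega
  have hqn : n ∣ q + 1 := by
    have h1 : q ≡ r [MOD n] := hqr.of_dvd (Dvd.intro_left _ rfl)
    have h2 : q + 1 ≡ r + 1 [MOD n] := h1.add_right 1
    exact (h2.dvd_iff dvd_rfl).2 hr2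
  have := Fact.mk hq
  obtain ⟨u, v, huv⟩ := Nat.Prime.sq_add_sq (p := q) (by omega)
  refine ⟨u, v, ?_⟩
  have : (n : ℤ) ∣ ((q + 1 : ℕ) : ℤ) := by exact_mod_cast hqn
  rw [← huv] at this
  push_cast at this
  convert this using 1; ring

lemma aux_round (D m : ℤ) (hD : 0 < D) : ∃ k : ℤ, -D ≤ 2 * (m - k * D) ∧ 2 * (m - k * D) ≤ D := by
  refine ⟨(2 * m + D) / (2 * D), ?_, ?_⟩
  · have := Int.ediv_mul_le (2 * m + D) (b := 2 * D) (by omega)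
    nlinarith
  · have := Int.lt_ediv_add_one_mul_self (2 * m + D) (b := 2 * D) (by omega)
    nlinarith

lemma aux_small (D a b c d : ℤ) (ha : -D ≤ 2 * a ∧ 2 * a ≤ D) (hb : -D ≤ 2 * b ∧ 2 * b ≤ D)
    (hc : -D ≤ 2 * c ∧ 2 * c ≤ D) (hd : -D ≤ 2 * d ∧ 2 * d ≤ D)
    (h : D * D ≤ a ^ 2 + b ^ 2 + c ^ 2 + d ^ 2) :
    D ∣ 2 * a ∧ D ∣ 2 * b ∧ D ∣ 2 * c ∧ D ∣ 2 * d := by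
  have key : ∀ x : ℤ, (-D ≤ 2 * x ∧ 2 * x ≤ D) → 4 * x ^ 2 ≤ D * D := by
    rintro x ⟨h1, h2⟩; nlinarith
  have key2 : ∀ x : ℤ, 4 * x ^ 2 = D * D → D ∣ 2 * x := by
    intro x hx
    have : (2 * x - D) * (2 * x + D) = 0 := by linarith
    rcases mul_eq_zero.1 this with h | h
    · exact ⟨1, by linarith⟩
    · exact ⟨-1, by linarith⟩
  have h1 := key a ha
  have h2 := key b hb
  have h3 := key c hc
  have h4 := key d hd
  exact ⟨key2 _ (by linarith), key2 _ (by linarith), key2 _ (by linarith), key2 _ (by linarith)⟩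

open Quaternion in
lemma aux_div (δ l : ℍ[ℤ]) (hδ : 0 < normSq δ)
    (hmin : ∀ κ : ℍ[ℤ], l - κ * δ ≠ 0 → normSq δ ≤ normSq (l - κ * δ)) :
    ∃ ρ : ℍ[ℤ], 2 * l = ρ * δ := by
  set D := normSq δ with hD
  set μ := l * star δ with hμ
  obtain ⟨k0, h0⟩ := aux_round D μ.re hδ
  obtain ⟨k1, h1⟩ := aux_round D μ.imI hδ
  obtain ⟨k2, h2⟩ := aux_round D μ.imJ hδ
  obtain ⟨k3, h3⟩ := aux_round D μ.imK hδ
  set κ : ℍ[ℤ] := qmk k0 k1 k2 k3 with hκ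
  by_cases hz : l - κ * δ = 0
  · refine ⟨2 * κ, ?_⟩
    rw [sub_eq_zero.1 hz, mul_assoc]
  have hm := hmin κ hz
  have e1 : (l - κ * δ) * star δ = μ - κ * (Int.cast D : ℍ[ℤ]) := by
    rw [sub_mul, mul_assoc, q_self_star]
  have e2 : normSq (l - κ * δ) * D = normSq (μ - κ * (Int.cast D : ℍ[ℤ])) := by
    rw [← e1, map_mul, normSq_star]
  have e3 : normSq (μ - κ * (Int.cast D : ℍ[ℤ])) = (μ.re - k0 * D) ^ 2 + (μ.imI - k1 * D) ^ 2
      + (μ.imJ - k2 * D) ^ 2 + (μ.imK - k3 * D) ^ 2 := by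
    rw [normSq_def']; simp [hκ, qmk_re, qmk_imI, qmk_imJ, qmk_imK]
  have e4 : D * D ≤ normSq (l - κ * δ) * D := by nlinarith
  rw [e2, e3] at e4
  obtain ⟨⟨r0, q0⟩, ⟨r1, q1⟩, ⟨r2, q2⟩, ⟨r3, q3⟩⟩ := aux_small D _ _ _ _ h0 h1 h2 h3 e4
  have e5 : 2 * (μ - κ * (Int.cast D : ℍ[ℤ])) = qmk r0 r1 r2 r3 * (Int.cast D : ℍ[ℤ]) := by
    rw [two_mul]
    ext <;> simp [hκ, qmk_re, qmk_imI, qmk_imJ, qmk_imK] <;> linarith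
  refine ⟨qmk r0 r1 r2 r3 + 2 * κ, ?_⟩
  have hne : (Int.cast D : ℍ[ℤ]) ≠ 0 := by
    intro h
    have := congrArg QuaternionAlgebra.re h
    simp at this; omega
  apply mul_right_cancel₀ hne
  have e6 : 2 * μ = (qmk r0 r1 r2 r3 + 2 * κ) * (Int.cast D : ℍ[ℤ]) := by
    rw [add_mul, ← e5]; noncomm_ring
  have c : Commute (Int.cast D : ℍ[ℤ]) δ := Int.cast_commute D δ
  calc 2 * l * (Int.cast D : ℍ[ℤ]) = 2 * μ * δ := by
        rw [hD, ← q_star_self, hμ]; noncomm_ring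
    _ = _ := by rw [e6, mul_assoc, c.eq, mul_assoc]

lemma aux_halve (n a b c d : ℤ)
    (h : a ^ 2 + b ^ 2 + c ^ 2 + d ^ 2 = 2 * n) :
    ∃ x y z w : ℤ, x ^ 2 + y ^ 2 + z ^ 2 + w ^ 2 = n ∧
      ∀ k : ℤ, k ∣ x → k ∣ y → k ∣ z → k ∣ w → k ∣ a ∧ k ∣ b ∧ k ∣ c ∧ k ∣ d := by
  have main : ∀ a b c d : ℤ, a ^ 2 + b ^ 2 + c ^ 2 + d ^ 2 = 2 * n → 2 ∣ a - b → 2 ∣ c - d →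
      ∃ x y z w : ℤ, x ^ 2 + y ^ 2 + z ^ 2 + w ^ 2 = n ∧
      ∀ k : ℤ, k ∣ x → k ∣ y → k ∣ z → k ∣ w → k ∣ a ∧ k ∣ b ∧ k ∣ c ∧ k ∣ d := by
    rintro a b c d h ⟨p, hp⟩ ⟨q, hq⟩
    obtain rfl : a = b + 2 * p := by linarith
    obtain rfl : c = d + 2 * q := by linarith
    refine ⟨b + p, p, d + q, q, by linarith, ?_⟩
    intro k h1 h2 h3 h4
    have hb : k ∣ b := (dvd_add_left h2).1 h1
    have hd : k ∣ d := (dvd_add_left h4).1 h3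
    exact ⟨dvd_add hb (h2.mul_left 2), hb, dvd_add hd (h4.mul_left 2), hd⟩
  have par : ∀ x : ℤ, ∃ y, x ^ 2 = x + 2 * y := by
    intro x
    obtain ⟨y, hy⟩ := Int.even_mul_pred_self x
    exact ⟨y, by linarith⟩
  obtain ⟨a', ha⟩ := par a
  obtain ⟨b', hb⟩ := par b
  obtain ⟨c', hc⟩ := par c
  obtain ⟨d', hd⟩ := par d
  have hs : 2 ∣ a + b + c + d := by omega
  have cases3 : (2 ∣ a - b ∧ 2 ∣ c - d) ∨ (2 ∣ a - c ∧ 2 ∣ b - d) ∨ (2 ∣ a - d ∧ 2 ∣ b - c) := by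
    omega
  rcases cases3 with ⟨h1, h2⟩ | ⟨h1, h2⟩ | ⟨h1, h2⟩
  · exact main a b c d h h1 h2
  · obtain ⟨x, y, z, w, e, f⟩ := main a c b d (by linarith) h1 h2
    exact ⟨x, y, z, w, e, fun k k1 k2 k3 k4 => by have := f k k1 k2 k3 k4; tauto⟩
  · obtain ⟨x, y, z, w, e, f⟩ := main a d b c (by linarith) h1 h2
    exact ⟨x, y, z, w, e, fun k k1 k2 k3 k4 => by have := f k k1 k2 k3 k4; tauto⟩

lemma aux_unit (n k x y z w : ℤ) (h4 : ¬ 4 ∣ n) (h : x ^ 2 + y ^ 2 + z ^ 2 + w ^ 2 = n)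
    (hx : k ∣ x) (hy : k ∣ y) (hz : k ∣ z) (hw : k ∣ w) (hk : k ∣ 2) : k ∣ 1 := by
  have h1 : k * k ∣ n := by
    rw [← h]
    simp only [sq]
    exact dvd_add (dvd_add (dvd_add (mul_dvd_mul hx hx) (mul_dvd_mul hy hy))
      (mul_dvd_mul hz hz)) (mul_dvd_mul hw hw)
  have hle := Int.le_of_dvd (by norm_num) hk
  have hge := Int.le_of_dvd (by norm_num) ((neg_dvd).2 hk)
  have : -2 ≤ k := by linarith
  interval_cases k
  · exact absurd (by simpa using h1) h4
  · norm_num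
  · simp at hk
  · norm_num
  · exact absurd (by simpa using h1) h4

open Quaternion in
lemma aux_prim (n : ℤ) (hn : 0 < n) (h4 : ¬ 4 ∣ n) :
    ∃ x y z w : ℤ, x ^ 2 + y ^ 2 + z ^ 2 + w ^ 2 = n ∧
      ∀ k : ℤ, k ∣ x → k ∣ y → k ∣ z → k ∣ w → k ∣ 1 := by
  obtain ⟨u, v, m, hm⟩ : ∃ u v : ℤ, n ∣ 1 + u ^ 2 + v ^ 2 := by
    lift n to ℕ using hn.le
    exact aux_alpha n (by omega) (by omega)
  set α : ℍ[ℤ] := qmk 1 u v 0 with hα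
  have hαN : normSq α = n * m := by rw [normSq_def', ← hm, hα]; simp only [qmk_re, qmk_imI, qmk_imJ, qmk_imK]; ring
  let S : Set ℍ[ℤ] := {l | ∃ x y : ℍ[ℤ], l = x * (Int.cast n : ℍ[ℤ]) + y * α}
  have hnS : (Int.cast n : ℍ[ℤ]) ∈ S := ⟨1, 0, by simp⟩
  have hαS : α ∈ S := ⟨0, 1, by simp⟩
  have hsub : ∀ l ∈ S, ∀ δ ∈ S, ∀ κ : ℍ[ℤ], l - κ * δ ∈ S := by
    rintro l ⟨x, y, rfl⟩ δ ⟨x', y', rfl⟩ κ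
    exact ⟨x - κ * x', y - κ * y', by noncomm_ring⟩
  have hN : ∀ l ∈ S, n ∣ normSq l := by
    rintro l ⟨x, y, rfl⟩
    have e : normSq (x * (Int.cast n : ℍ[ℤ]) + y * α)
        = n * (n * normSq x + m * normSq y + 2 * (x * star (y * α)).re) := by
      have h1 : normSq (y * α) = normSq y * (n * m) := by rw [map_mul, hαN]
      have h2 : normSq (x * (Int.cast n : ℍ[ℤ]) + y * α) = n * n * normSq x + normSq (y * α)
          + n * (2 * (x * star (y * α)).re) := by
        generalize y * α = β
        simp [normSq_def']
        ring
      rw [h2, h1]; ring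
    exact ⟨_, e⟩
  -- minimal element
  let P : ℕ → Prop := fun N => ∃ l ∈ S, l ≠ 0 ∧ (normSq l).toNat = N
  have hα0 : α ≠ 0 := by
    intro h; have := congrArg QuaternionAlgebra.re h; simp [hα, qmk_re, qmk_imI, qmk_imJ, qmk_imK] at this
  have hP : ∃ N, P N := ⟨_, α, hαS, hα0, rfl⟩
  classical
  obtain ⟨δ, hδS, hδ0, hδN⟩ := Nat.find_spec hP
  have hnn : ∀ l : ℍ[ℤ], 0 ≤ normSq l := fun l => by rw [normSq_def']; positivity
  have hpos : ∀ l : ℍ[ℤ], l ≠ 0 → 0 < normSq l := fun l hl =>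
    lt_of_le_of_ne (hnn l) (fun h => hl (normSq_eq_zero.1 h.symm))
  have hmin : ∀ l ∈ S, l ≠ 0 → normSq δ ≤ normSq l := by
    intro l hl hl0
    have h1 := Nat.find_min' hP ⟨l, hl, hl0, rfl⟩
    rw [← hδN] at h1
    have := hnn l
    have := hnn δ
    omega
  have hdiv : ∀ l ∈ S, ∃ ρ : ℍ[ℤ], 2 * l = ρ * δ := fun l hl =>
    aux_div δ l (hpos δ hδ0) (fun κ hκ => hmin _ (hsub l hl δ hδS κ) hκ)
  obtain ⟨η, hη⟩ := hdiv _ hnS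
  obtain ⟨ρ, hρ⟩ := hdiv _ hαS
  obtain ⟨s, hs⟩ := hN δ hδS
  have hspos : 0 < s := by
    have := hpos δ hδ0
    rw [hs] at this
    exact pos_of_mul_pos_right this hn.le
  have hn0 : (Int.cast n : ℍ[ℤ]) ≠ 0 := by
    intro h
    have := congrArg QuaternionAlgebra.re h
    simp at this; omega
  have hsη : 2 * star δ = (Int.cast s : ℍ[ℤ]) * η := by
    apply mul_left_cancel₀ hn0
    have c : Commute (Int.cast n : ℍ[ℤ]) 2 := Int.cast_commute n 2
    have c2 : Commute ((Int.cast n : ℍ[ℤ]) * (Int.cast s : ℍ[ℤ])) η :=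
      (Int.cast_commute n η).mul_left (Int.cast_commute s η)
    rw [← mul_assoc, c.eq, hη, mul_assoc, q_self_star, hs, ← mul_assoc, c2.eq, Int.cast_mul]
  have hsη' : 2 * δ = (Int.cast s : ℍ[ℤ]) * star η := by
    have := congrArg star hsη
    have c : Commute δ 2 := (Nat.cast_commute 2 δ).symm
    have c2 : Commute (Int.cast s : ℍ[ℤ]) (star η) := Int.cast_commute s _
    simp only [star_mul, star_star, star_intCast] at this
    rw [c2.eq, ← this, ← c.eq]; simp
  have hs4 : s ∣ 4 := by
    have : (4 : ℍ[ℤ]) * α = (Int.cast s : ℍ[ℤ]) * (ρ * star η) := by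
      have c : Commute (Int.cast s : ℍ[ℤ]) ρ := Int.cast_commute s _
      have c2 : Commute (2 : ℍ[ℤ]) ρ := Nat.cast_commute 2 ρ
      calc (4 : ℍ[ℤ]) * α = 2 * (2 * α) := by noncomm_ring
        _ = ρ * (2 * δ) := by rw [hρ, ← mul_assoc, c2.eq, mul_assoc]
        _ = _ := by rw [hsη', ← mul_assoc, ← c.eq, mul_assoc]
    have h2 : (4 : ℍ[ℤ]) * α = α + α + (α + α) := by noncomm_ring
    rw [h2] at this
    have h3 := congrArg QuaternionAlgebra.re this
    refine ⟨(ρ * star η).re, ?_⟩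
    simp only [re_add, hα, qmk_re] at h3
    simpa using h3
  have hkdvd : ∀ (k : ℤ) (ε : ℍ[ℤ]), k ∣ ε.re → k ∣ ε.imI → k ∣ ε.imJ → k ∣ ε.imK →
      ∀ τ : ℍ[ℤ], k ∣ (τ * ε).re := by
    intro k ε h1 h2 h3 h4 τ
    rw [re_mul]
    exact dvd_sub (dvd_sub (dvd_sub (h1.mul_left _) (h2.mul_left _)) (h3.mul_left _))
      (h4.mul_left _)
  have hre2 : (2 * α).re = 2 := by rw [two_mul]; simp [hα, qmk_re, qmk_imI, qmk_imJ, qmk_imK]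
  have hδk : ∀ k : ℤ, k ∣ δ.re → k ∣ δ.imI → k ∣ δ.imJ → k ∣ δ.imK → k ∣ 2 := by
    intro k h1 h2 h3 h4
    have := hkdvd k δ h1 h2 h3 h4 ρ
    rwa [← hρ, hre2] at this
  have hδsq := normSq_def' δ
  rw [hs] at hδsq
  have hs124 : s = 1 ∨ s = 2 ∨ s = 4 := by
    have := Int.le_of_dvd (by norm_num) hs4
    interval_cases s <;> omega
  rcases hs124 with rfl | rfl | rfl
  · exact ⟨δ.re, δ.imI, δ.imJ, δ.imK, by linarith, fun k h1 h2 h3 h5 =>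
      aux_unit n k _ _ _ _ h4 (by linarith) h1 h2 h3 h5 (hδk k h1 h2 h3 h5)⟩
  · obtain ⟨x, y, z, w, e, f⟩ := aux_halve n δ.re δ.imI δ.imJ δ.imK (by linarith)
    refine ⟨x, y, z, w, e, fun k h1 h2 h3 h5 => ?_⟩
    obtain ⟨g1, g2, g3, g4⟩ := f k h1 h2 h3 h5
    exact aux_unit n k _ _ _ _ h4 e h1 h2 h3 h5 (hδk k g1 g2 g3 g4)
  · have hδη : δ + δ = star η + star η + (star η + star η) := by
      rw [← two_mul, hsη']; push_cast; noncomm_ring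
    have r0 := congrArg QuaternionAlgebra.re hδη
    have r1 := congrArg QuaternionAlgebra.imI hδη
    have r2 := congrArg QuaternionAlgebra.imJ hδη
    have r3 := congrArg QuaternionAlgebra.imK hδη
    simp only [re_add, imI_add, imJ_add, imK_add] at r0 r1 r2 r3
    have t0 : δ.re = 2 * (star η).re := by linarith
    have t1 : δ.imI = 2 * (star η).imI := by linarith
    have t2 : δ.imJ = 2 * (star η).imJ := by linarith
    have t3 : δ.imK = 2 * (star η).imK := by linarith
    have e : (star η).re ^ 2 + (star η).imI ^ 2 + (star η).imJ ^ 2 + (star η).imK ^ 2 = n := by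
      rw [t0, t1, t2, t3] at hδsq; linarith
    refine ⟨_, _, _, _, e, fun k h1 h2 h3 h5 => ?_⟩
    exact aux_unit n k _ _ _ _ h4 e h1 h2 h3 h5
      (hδk k (t0 ▸ h1.mul_left 2) (t1 ▸ h2.mul_left 2) (t2 ▸ h3.mul_left 2) (t3 ▸ h5.mul_left 2))

def Prim4 (n x y z w : ℤ) : Prop := x ^ 2 + y ^ 2 + z ^ 2 + w ^ 2 = n ∧
      ∀ k : ℤ, k ∣ x → k ∣ y → k ∣ z → k ∣ w → k ∣ 1

lemma Prim4.s12 {n x y z w : ℤ} (h : Prim4 n x y z w) : Prim4 n y x z w :=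
  ⟨by linarith [h.1], fun k a b c d => h.2 k b a c d⟩
lemma Prim4.s23 {n x y z w : ℤ} (h : Prim4 n x y z w) : Prim4 n x z y w :=
  ⟨by linarith [h.1], fun k a b c d => h.2 k a c b d⟩
lemma Prim4.s34 {n x y z w : ℤ} (h : Prim4 n x y z w) : Prim4 n x y w z :=
  ⟨by linarith [h.1], fun k a b c d => h.2 k a b d c⟩

lemma aux_sorted (n : ℤ) (hn : 0 < n) (h4 : ¬ 4 ∣ n) :
    ∃ x y z w : ℤ, Prim4 n x y z w ∧
      ((n % 4 = 1 ∧ x % 2 = 1 ∧ y % 2 = 0 ∧ z % 2 = 0 ∧ w % 2 = 0) ∨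
       (n % 4 = 2 ∧ x % 2 = 1 ∧ y % 2 = 1 ∧ z % 2 = 0 ∧ w % 2 = 0) ∨
       (n % 4 = 3 ∧ x % 2 = 0 ∧ y % 2 = 1 ∧ z % 2 = 1 ∧ w % 2 = 1)) := by
  obtain ⟨x, y, z, w, h⟩ : ∃ x y z w, Prim4 n x y z w := aux_prim n hn h4
  have par : ∀ x : ℤ, (x % 2 = 0 ∧ x ^ 2 % 4 = 0) ∨ (x % 2 = 1 ∧ x ^ 2 % 4 = 1) := by
    intro x
    rcases Int.even_or_odd' x with ⟨k, rfl | rfl⟩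
    · left; refine ⟨by omega, ?_⟩
      have : (2 * k) ^ 2 = 4 * k ^ 2 := by ring
      omega
    · right; refine ⟨by omega, ?_⟩
      have : (2 * k + 1) ^ 2 = 4 * (k ^ 2 + k) + 1 := by ring
      omega
  have h0 := h.1
  rcases par x with ⟨hx, hx'⟩ | ⟨hx, hx'⟩ <;> rcases par y with ⟨hy, hy'⟩ | ⟨hy, hy'⟩ <;>
    rcases par z with ⟨hz, hz'⟩ | ⟨hz, hz'⟩ <;> rcases par w with ⟨hw, hw'⟩ | ⟨hw, hw'⟩
  · omega
  · exact ⟨_, _, _, _, h.s34.s23.s12, by omega⟩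
  · exact ⟨_, _, _, _, h.s23.s12, by omega⟩
  · exact ⟨_, _, _, _, h.s23.s12.s34.s23, by omega⟩
  · exact ⟨_, _, _, _, h.s12, by omega⟩
  · exact ⟨_, _, _, _, h.s12.s34.s23, by omega⟩
  · exact ⟨_, _, _, _, h.s12.s23, by omega⟩
  · exact ⟨_, _, _, _, h, by omega⟩
  · exact ⟨_, _, _, _, h, by omega⟩
  · exact ⟨_, _, _, _, h.s34.s23, by omega⟩
  · exact ⟨_, _, _, _, h.s23, by omega⟩
  · exact ⟨_, _, _, _, h.s12, by omega⟩
  · exact ⟨_, _, _, _, h, by omega⟩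
  · exact ⟨_, _, _, _, h.s23.s12, by omega⟩
  · exact ⟨_, _, _, _, h.s34.s23.s12, by omega⟩
  · omega

lemma aux_int (n x y z w : ℤ) (h : Prim4 n x y z w) (q : ℚ)
    (hx : ∃ k : ℤ, q * x = k) (hy : ∃ k : ℤ, q * y = k) (hz : ∃ k : ℤ, q * z = k)
    (hw : ∃ k : ℤ, q * w = k) : ∃ k : ℤ, q = k := by
  have key : ∀ x : ℤ, (∃ k : ℤ, q * x = k) → (q.den : ℤ) ∣ x := by
    rintro x ⟨k, hk⟩
    have h1 : q.num * x = k * q.den := by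
      have h2 : (q.den : ℚ) ≠ 0 := by exact_mod_cast q.den_nz
      have h3 := Rat.num_div_den q
      rw [← h3] at hk
      field_simp at hk
      have h4 : (q.num : ℚ) * x = q.den * k := by linarith
      have h5 : q.num * x = q.den * k := by exact_mod_cast h4
      linarith
    have hc : IsCoprime (q.den : ℤ) q.num := by
      have := q.reduced
      rw [Int.isCoprime_iff_nat_coprime]
      simpa using this.symm
    exact hc.dvd_of_dvd_mul_left ⟨k, by linarith⟩
  have h1 := h.2 _ (key x hx) (key y hy) (key z hz) (key w hw)
  have h2 : q.den = 1 := by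
    have : q.den ∣ 1 := by exact_mod_cast h1
    simpa using this
  exact ⟨q.num, (Rat.den_eq_one_iff q).1 h2 |>.symm⟩

def sig8 : (Fin 8 → ℚ) →ₗ[ℚ] (Fin 8 → ℚ) where
  toFun v := ![v 1, v 0, -v 3, -v 2, -v 5, -v 4, -v 7, -v 6]
  map_add' u v := by
    ext i; fin_cases i <;> simp <;> ring
  map_smul' c v := by
    ext i; fin_cases i <;> simp

lemma sig8_apply (v : Fin 8 → ℚ) :
    sig8 v = ![v 1, v 0, -v 3, -v 2, -v 5, -v 4, -v 7, -v 6] := rfl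

lemma sig8_mem (v : Fin 8 → ℚ) (hv : v ∈ E8lat) : sig8 v ∈ E8lat := by
  obtain ⟨h, k, hk⟩ := hv
  simp only [Fin.sum_univ_eight] at hk
  rcases h with h | h
  · choose f hf using h
    refine ⟨Or.inl ?_, k - (f 2 + f 3 + f 4 + f 5 + f 6 + f 7), ?_⟩
    · simp only [Fin.forall_fin_succ, sig8_apply]
      simp
      simp only [hf]
      norm_cast
      simp
    · simp only [Fin.sum_univ_eight, sig8_apply]
      simp
      simp only [hf] at hk ⊢
      linarith
  · choose f hf using h
    refine ⟨Or.inr ?_, k - (f 2 + f 3 + f 4 + f 5 + f 6 + f 7) - 3, ?_⟩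
    · intro i
      have hneg : ∀ j, ∃ n : ℤ, -v j = n + 1/2 := fun j =>
        ⟨-f j - 1, by rw [hf]; push_cast; ring⟩
      fin_cases i
      · exact ⟨_, hf 1⟩
      · exact ⟨_, hf 0⟩
      · exact hneg 3
      · exact hneg 2
      · exact hneg 5
      · exact hneg 4
      · exact hneg 7
      · exact hneg 6
    · simp only [Fin.sum_univ_eight, sig8_apply]
      simp
      simp only [hf] at hk ⊢
      linarith

lemma sig8_sig8 (v : Fin 8 → ℚ) : sig8 (sig8 v) = v := by
  ext i; fin_cases i <;> simp [sig8_apply]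

lemma E8_int (v : Fin 8 → ℚ) (hv : v ∈ E8lat) (i j : Fin 8) :
    (∃ k : ℤ, v i + v j = k) ∧ (∃ k : ℤ, v i - v j = k) := by
  rcases hv.1 with h | h <;> obtain ⟨m, hm⟩ := h i <;> obtain ⟨n, hn⟩ := h j <;> rw [hm, hn]
  · exact ⟨⟨m + n, by push_cast; ring⟩, ⟨m - n, by push_cast; ring⟩⟩
  · exact ⟨⟨m + n + 1, by push_cast; ring⟩, ⟨m - n, by push_cast; ring⟩⟩

theorem aux_main (a d t : ℤ) (ht : a + d = 4 * t) (x1 x2 x3 x4 y1 y2 y3 y4 : ℤ)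
    (hx : Prim4 a x1 x2 x3 x4) (hy : Prim4 d y1 y2 y3 y4)
    (h1 : (y1 + x2 + x3 + x4) % 2 = 0) (h2 : (x1 + y2 + x3 + x4) % 2 = 0)
    (h3 : (x1 + x2 + y3 + x4) % 2 = 0) (h4 : (x1 + x2 + x3 + y4) % 2 = 0)
    (hodd : (x1 - x3) % 2 = 1) :
    ∃ z₁ z₂ : Fin 8 → ℚ, z₁ ∈ E8lat ∧ z₂ ∈ E8lat ∧
      ip8 z₁ z₁ = 2 * a ∧ ip8 z₂ z₂ = 2 * t ∧ ip8 z₁ z₂ = -a ∧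
      (∀ x ∈ E8lat, (∃ p q : ℚ, x = p • z₁ + q • z₂) →
        ∃ m n : ℤ, x = m • z₁ + n • z₂) ∧
      ∃ σ : (Fin 8 → ℚ) →ₗ[ℚ] (Fin 8 → ℚ),
        (∀ x y, ip8 (σ x) (σ y) = ip8 x y) ∧ ⇑σ '' E8lat = E8lat ∧
        σ z₁ = -z₁ ∧ σ z₂ = z₁ + z₂ := by
  have hxa : (x1 : ℚ) ^ 2 + x2 ^ 2 + x3 ^ 2 + x4 ^ 2 = a := by exact_mod_cast hx.1
  have hyd : (y1 : ℚ) ^ 2 + y2 ^ 2 + y3 ^ 2 + y4 ^ 2 = d := by exact_mod_cast hy.1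
  have htq : (a : ℚ) + d = 4 * t := by exact_mod_cast ht
  refine ⟨![x1, -x1, x2, x2, x3, x3, x4, x4],
    ![(y1 - x1) / 2, (y1 + x1) / 2, (y2 - x2) / 2, (-y2 - x2) / 2, (y3 - x3) / 2, (-y3 - x3) / 2,
      (y4 - x4) / 2, (-y4 - x4) / 2], ?_, ?_, ?_, ?_, ?_, ?_, sig8, ?_, ?_, ?_, ?_⟩
  · refine ⟨Or.inl ?_, x2 + x3 + x4, ?_⟩
    · intro i
      fin_cases i
      · exact ⟨x1, rfl⟩
      · exact ⟨-x1, by simp⟩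
      · exact ⟨x2, rfl⟩
      · exact ⟨x2, rfl⟩
      · exact ⟨x3, rfl⟩
      · exact ⟨x3, rfl⟩
      · exact ⟨x4, rfl⟩
      · exact ⟨x4, rfl⟩
    · simp [Fin.sum_univ_eight]; ring
  · have hI : ∀ m : ℤ, m % 2 = 0 → ∀ r : ℚ, r = m / 2 → ∃ n : ℤ, r = n := by
      intro m hm r hr
      obtain ⟨k, rfl⟩ : (2 : ℤ) ∣ m := by omega
      exact ⟨k, by rw [hr]; push_cast; ring⟩
    have hH : ∀ m : ℤ, m % 2 = 1 → ∀ r : ℚ, r = m / 2 → ∃ n : ℤ, r = n + 1 / 2 := by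
      intro m hm r hr
      obtain ⟨k, rfl⟩ : ∃ k, m = 2 * k + 1 := ⟨m / 2, by omega⟩
      exact ⟨k, by rw [hr]; push_cast; ring⟩
    constructor
    · rcases Int.emod_two_eq_zero_or_one (x1 + x2 + x3 + x4) with hs | hs
      · left
        intro i
        fin_cases i
        · exact hI (y1 - x1) (by omega) _ (by simp)
        · exact hI (y1 + x1) (by omega) _ (by simp)
        · exact hI (y2 - x2) (by omega) _ (by simp)
        · exact hI (-y2 - x2) (by omega) _ (by simp)
        · exact hI (y3 - x3) (by omega) _ (by simp)
        · exact hI (-y3 - x3) (by omega) _ (by simp)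
        · exact hI (y4 - x4) (by omega) _ (by simp)
        · exact hI (-y4 - x4) (by omega) _ (by simp)
      · right
        intro i
        fin_cases i
        · exact hH (y1 - x1) (by omega) _ (by simp)
        · exact hH (y1 + x1) (by omega) _ (by simp)
        · exact hH (y2 - x2) (by omega) _ (by simp)
        · exact hH (-y2 - x2) (by omega) _ (by simp)
        · exact hH (y3 - x3) (by omega) _ (by simp)
        · exact hH (-y3 - x3) (by omega) _ (by simp)
        · exact hH (y4 - x4) (by omega) _ (by simp)
        · exact hH (-y4 - x4) (by omega) _ (by simp)
    · obtain ⟨k, hk⟩ : (2 : ℤ) ∣ y1 - x2 - x3 - x4 := by omega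
      refine ⟨k, ?_⟩
      have : (y1 : ℚ) - x2 - x3 - x4 = 2 * k := by exact_mod_cast hk
      rw [← this]
      simp [Fin.sum_univ_eight]; ring
  · simp [ip8, Fin.sum_univ_eight]; linarith
  · simp [ip8, Fin.sum_univ_eight]; linarith
  · simp [ip8, Fin.sum_univ_eight]; linarith
  · rintro v hv ⟨p, q, hpq⟩
    have c0 := congrFun hpq 0
    have c1 := congrFun hpq 1
    have c2 := congrFun hpq 2
    have c3 := congrFun hpq 3
    have c4 := congrFun hpq 4
    have c5 := congrFun hpq 5
    have c6 := congrFun hpq 6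
    have c7 := congrFun hpq 7
    simp at c0 c1 c2 c3 c4 c5 c6 c7
    have tr : ∀ r s : ℚ, r = s → (∃ k : ℤ, r = k) → ∃ k : ℤ, s = k := fun r s h => h ▸ id
    obtain ⟨n, rfl⟩ := aux_int d y1 y2 y3 y4 hy q
      (tr _ _ (by rw [c0, c1]; ring) (E8_int v hv 0 1).1)
      (tr _ _ (by rw [c2, c3]; ring) (E8_int v hv 2 3).2)
      (tr _ _ (by rw [c4, c5]; ring) (E8_int v hv 4 5).2)
      (tr _ _ (by rw [c6, c7]; ring) (E8_int v hv 6 7).2)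
    obtain ⟨m', hm'⟩ := aux_int a x1 x2 x3 x4 hx (2 * p - n)
      (tr _ _ (by rw [c0, c1]; ring) (E8_int v hv 0 1).2)
      (tr _ _ (by rw [c2, c3]; ring) (E8_int v hv 2 3).1)
      (tr _ _ (by rw [c4, c5]; ring) (E8_int v hv 4 5).1)
      (tr _ _ (by rw [c6, c7]; ring) (E8_int v hv 6 7).1)
    obtain ⟨k, hk⟩ := (E8_int v hv 0 4).2
    have hp : p = ((m' + n : ℤ) : ℚ) / 2 := by push_cast; linarith
    rw [c0, c4, hp] at hk
    have e : (m' + n) * (x1 - x3) + n * ((y1 - x1) - (y3 - x3)) = 2 * k := by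
      have : (((m' + n) * (x1 - x3) + n * ((y1 - x1) - (y3 - x3)) : ℤ) : ℚ) = (2 * k : ℤ) := by
        push_cast at hk ⊢; linarith
      exact_mod_cast this
    obtain ⟨g, hg⟩ : (2 : ℤ) ∣ (y1 - x1) - (y3 - x3) := by omega
    obtain ⟨r, hr⟩ : ∃ r, x1 - x3 = 2 * r + 1 := ⟨(x1 - x3) / 2, by omega⟩
    rw [hg, hr] at e
    refine ⟨k - n * g - (m' + n) * r, n, ?_⟩
    have hp2 : p = ((k - n * g - (m' + n) * r : ℤ) : ℚ) := by
      rw [hp]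
      have : m' + n = 2 * (k - n * g - (m' + n) * r) := by linarith
      have h' : ((m' + n : ℤ) : ℚ) = 2 * ((k - n * g - (m' + n) * r : ℤ) : ℚ) := by
        exact_mod_cast this
      rw [h']; ring
    rw [hpq, hp2, Int.cast_smul_eq_zsmul, Int.cast_smul_eq_zsmul]
  · intro u v
    simp [ip8, Fin.sum_univ_eight, sig8_apply]; ring
  · ext v
    constructor
    · rintro ⟨u, hu, rfl⟩; exact sig8_mem u hu
    · intro hv; exact ⟨sig8 v, sig8_mem v hv, sig8_sig8 v⟩
  · ext i; fin_cases i <;> simp [sig8_apply]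
  · ext i; fin_cases i <;> simp [sig8_apply] <;> ring

/-- The lattice `Q_{(a,d)}` with Gram matrix `[[2a, −a],[−a, 2t]]` (where
`a + d = 4t`, `4 ∤ a`, `4 ∤ d`) admits a primitive embedding into `E₈` along which
the reflection along `z₁` extends to an isometry of `E₈`. -/
theorem stmt1 (a d t : ℤ) (ha : 0 < a) (hd : 0 < d)
    (h4a : ¬ (4 ∣ a)) (h4d : ¬ (4 ∣ d)) (ht : a + d = 4 * t) :
    ∃ z₁ z₂ : Fin 8 → ℚ, z₁ ∈ E8lat ∧ z₂ ∈ E8lat ∧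
      ip8 z₁ z₁ = 2 * a ∧ ip8 z₂ z₂ = 2 * t ∧ ip8 z₁ z₂ = -a ∧
      (∀ x ∈ E8lat, (∃ p q : ℚ, x = p • z₁ + q • z₂) →
        ∃ m n : ℤ, x = m • z₁ + n • z₂) ∧
      ∃ σ : (Fin 8 → ℚ) →ₗ[ℚ] (Fin 8 → ℚ),
        (∀ x y, ip8 (σ x) (σ y) = ip8 x y) ∧ ⇑σ '' E8lat = E8lat ∧
        σ z₁ = -z₁ ∧ σ z₂ = z₁ + z₂ := by
  obtain ⟨x1, x2, x3, x4, hx, hx'⟩ := aux_sorted a ha h4a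
  obtain ⟨y1, y2, y3, y4, hy, hy'⟩ := aux_sorted d hd h4d
  exact aux_main a d t ht x1 x2 x3 x4 y1 y2 y3 y4 hx hy (by omega) (by omega) (by omega)
    (by omega) (by omega)
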